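/- arXiv:1811.09609 — 2 statements merged into one kernel-verified Lean document; each statement's English description precedes it below -/
import Mathlib

section
/- Let T be the tolerance induced by an irredundant covering of a set U and let E be an equivalence on U such that T is E-compatible. Then the following are equivalent: (a) for every family H of subsets of U there exists Y ⊆ U with Y_E = ⋂_{X∈H} X_E and Y^T = ((⋂_{X∈H} X^T)_T)^T (i.e., RS(E,T) is a complete sublattice of ℘(U)_E × ℘(U)^T); (b) for each x ∈ Σ_E \ Σ_T there exists an element y ∉ Σ_E with T(y) ⊆ T(x). -/
/-- The relational product `R ∘ S = {(x,y) | ∃ z, x R z and z S y}`. -/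
def relComp {U : Type*} (R S : U → U → Prop) : U → U → Prop :=
  fun x y => ∃ z, R x z ∧ S z y

/-- The lower approximation `X_R = {x | R(x) ⊆ X}`. -/
def lowerAppr {U : Type*} (R : U → U → Prop) (X : Set U) : Set U :=
  {x | ∀ y, R x y → y ∈ X}

/-- The upper approximation `X^R = {x | R(x) ∩ X ≠ ∅}`. -/
def upperAppr {U : Type*} (R : U → U → Prop) (X : Set U) : Set U :=
  {x | ∃ y, R x y ∧ y ∈ X}

/-- The neighbourhood `R(x) = {y | x R y}`. -/
def nbhd {U : Type*} (R : U → U → Prop) (x : U) : Set U :=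
  {y | R x y}

/-- A tolerance `T` is `E`-compatible if `E ∘ T ⊆ T`. -/
def Compatible {U : Type*} (E T : U → U → Prop) : Prop :=
  ∀ x y, relComp E T x y → T x y

/-- `Σ_E`: the set of elements whose `E`-class is a singleton. -/
def SigmaE {U : Type*} (E : U → U → Prop) : Set U :=
  {x | {y | E x y} = {x}}

/-- `Σ_T`: the set of elements whose `T`-neighbourhood is a singleton. -/
def SigmaT {U : Type*} (T : U → U → Prop) : Set U :=
  {x | nbhd T x = {x}}

/-- In an irredundant covering, any two elements of a common member lie in the neighbourhood of an
element `b` belonging to only one member; that neighbourhood is a clique of the tolerance. -/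
theorem exists_nbhd_clique_of_irredundant {U : Type*} {C : Set (Set U)}
    (hirr : ∀ B ∈ C, ⋃₀ (C \ {B}) ≠ Set.univ) (hcov : ⋃₀ C = Set.univ) {x y : U}
    (hxy : ∃ B ∈ C, x ∈ B ∧ y ∈ B) :
    ∃ b, (∃ B ∈ C, b ∈ B ∧ x ∈ B) ∧ (∃ B ∈ C, b ∈ B ∧ y ∈ B) ∧
      ∀ u v, (∃ B ∈ C, b ∈ B ∧ u ∈ B) → (∃ B ∈ C, b ∈ B ∧ v ∈ B) → ∃ B ∈ C, u ∈ B ∧ v ∈ B := by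
  obtain ⟨B, hB, hx, hy⟩ := hxy
  obtain ⟨b, hb⟩ := (Set.ne_univ_iff_exists_notMem _).1 (hirr B hB)
  have huniq : ∀ D ∈ C, b ∈ D → D = B := fun D hD hbD => by
    by_contra hne
    exact hb ⟨D, ⟨hD, hne⟩, hbD⟩
  obtain ⟨D, hD, hbD⟩ : b ∈ ⋃₀ C := hcov ▸ Set.mem_univ b
  have hbB : b ∈ B := huniq D hD hbD ▸ hbD
  refine ⟨b, ⟨B, hB, hbB, hx⟩, ⟨B, hB, hbB, hy⟩, ?_⟩
  rintro u v ⟨D, hD, hbD, hu⟩ ⟨D', hD', hbD', hv⟩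
  exact ⟨B, hB, huniq D hD hbD ▸ hu, huniq D' hD' hbD' ▸ hv⟩

theorem upperAppr_lowerAppr_subset {U : Type*} {T : U → U → Prop} (hsymm : ∀ x y, T x y → T y x)
    (Z : Set U) : upperAppr T (lowerAppr T Z) ⊆ Z :=
  fun _ ⟨y, hxy, hy⟩ => hy _ (hsymm _ y hxy)

theorem Compatible.nbhd_subset {U : Type*} {E T : U → U → Prop} (h : Compatible E T) {x y : U}
    (hxy : E x y) : nbhd T y ⊆ nbhd T x :=
  fun z hz => h x z ⟨y, hxy, hz⟩

theorem mem_lowerAppr_of_equiv {U : Type*} {E : U → U → Prop} (hE : Equivalence E) {X : Set U}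
    {x y : U} (hxy : E x y) (hx : x ∈ lowerAppr E X) : y ∈ lowerAppr E X :=
  fun z hz => hx z (hE.trans hxy hz)

theorem lowerAppr_subset {U : Type*} {E : U → U → Prop} (hE : Equivalence E) (X : Set U) :
    lowerAppr E X ⊆ X :=
  fun x hx => hx x (hE.refl x)

theorem mem_lowerAppr_of_mem_sigmaE {U : Type*} {E : U → U → Prop} {X : Set U} {x : U}
    (hx : x ∈ SigmaE E) (hxX : x ∈ X) : x ∈ lowerAppr E X := fun y hy => by
  have : y ∈ ({x} : Set U) := hx ▸ hy
  rwa [Set.mem_singleton_iff.1 this]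

/-- for a tolerance `T` induced by an irredundant covering and an
equivalence `E` with `T` `E`-compatible: `RS(E,T)` is a complete sublattice of
`℘(U)_E × ℘(U)^T` iff for each `x ∈ Σ_E \ Σ_T` there is `y ∉ Σ_E` with `T(y) ⊆ T(x)`. -/
theorem RS_complete_sublattice_iff {U : Type*} (C : Set (Set U))
    (hne : ∀ B ∈ C, B.Nonempty) (hcov : ⋃₀ C = Set.univ)
    (hirr : ∀ B ∈ C, ⋃₀ (C \ {B}) ≠ Set.univ)
    (T : U → U → Prop) (hT : T = fun x y : U => ∃ B ∈ C, x ∈ B ∧ y ∈ B)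
    (E : U → U → Prop) (hE : Equivalence E) (hcomp : Compatible E T) :
    (∀ H : Set (Set U), ∃ Y : Set U,
        lowerAppr E Y = ⋂ X ∈ H, lowerAppr E X ∧
        upperAppr T Y = upperAppr T (lowerAppr T (⋂ X ∈ H, upperAppr T X)))
    ↔ (∀ x ∈ SigmaE E \ SigmaT T, ∃ y, y ∉ SigmaE E ∧ nbhd T y ⊆ nbhd T x) := by
  have hrefl : ∀ x, T x x := fun x => by
    obtain ⟨B, hB, hx⟩ : x ∈ ⋃₀ C := hcov ▸ Set.mem_univ x
    rw [hT]
    exact ⟨B, hB, hx, hx⟩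
  have hsymm : ∀ x y, T x y → T y x := by
    rw [hT]
    rintro x y ⟨B, hB, hx, hy⟩
    exact ⟨B, hB, hy, hx⟩
  have hclique : ∀ x y, T x y → ∃ b, T b x ∧ T b y ∧ ∀ u v, T b u → T b v → T u v := by
    rw [hT]
    exact fun x y hxy => exists_nbhd_clique_of_irredundant hirr hcov hxy
  constructor
  · rintro h x ⟨-, hxT⟩
    by_contra! hno
    obtain ⟨z, hxz, hzx⟩ : ∃ z, T x z ∧ z ≠ x := by
      by_contra! hall
      exact hxT (Set.Subset.antisymm hall (Set.singleton_subset_iff.2 (hrefl x)))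
    obtain ⟨b, hbx, hbz, hb⟩ := hclique x z hxz
    obtain ⟨c, hbc, hcb⟩ : ∃ c, T b c ∧ c ≠ b := by
      by_cases hxb : x = b
      · exact ⟨z, hbz, hxb ▸ hzx⟩
      · exact ⟨x, hbx, hxb⟩
    obtain ⟨Y, hYE, hYT⟩ := h {{b}, {c}}
    have hbY : b ∈ upperAppr T Y := by
      rw [hYT]
      refine ⟨b, hrefl b, fun u hu => ?_⟩
      simp only [Set.mem_insert_iff, Set.mem_singleton_iff, Set.iInter_iInter_eq_or_left,
        Set.iInter_iInter_eq_left]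
      exact ⟨⟨b, hsymm _ _ hu, rfl⟩, ⟨c, hb _ _ hu hbc, rfl⟩⟩
    obtain ⟨y, hby, hyY⟩ := hbY
    have hyx : nbhd T y ⊆ nbhd T x := fun u hu => by
      have huY : u ∈ upperAppr T Y := ⟨y, hsymm _ _ hu, hyY⟩
      rw [hYT] at huY
      obtain ⟨_, hub, rfl⟩ := Set.mem_iInter₂.1 (upperAppr_lowerAppr_subset hsymm _ huY) {b}
        (Set.mem_insert _ _)
      exact hb _ _ hbx (hsymm _ _ hub)
    have hyE : y ∈ SigmaE E := by
      by_contra hyE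
      exact hno y hyE hyx
    have hy := mem_lowerAppr_of_mem_sigmaE hyE hyY
    rw [hYE, Set.mem_iInter₂] at hy
    have hyb : y = b :=
      Set.mem_singleton_iff.1 (lowerAppr_subset hE _ (hy {b} (Set.mem_insert _ _)))
    have hyc : y = c :=
      Set.mem_singleton_iff.1 (lowerAppr_subset hE _ (hy {c} (Set.mem_insert_of_mem _ rfl)))
    exact hcb (hyc.symm.trans hyb)
  · intro h H
    let S : Setoid U := ⟨E, hE⟩
    let rep : U → U := fun x => (Quotient.mk S x).out
    have hrep : ∀ x, E (rep x) x := fun x => Quotient.exact (Quotient.out_eq (Quotient.mk S x))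
    have hrep_eq : ∀ x y, E x y → rep x = rep y := fun x y hxy =>
      congrArg Quotient.out (Quotient.sound (s := S) hxy)
    set A : Set U := ⋂ X ∈ H, lowerAppr E X with hA
    set Z : Set U := ⋂ X ∈ H, upperAppr T X with hZ
    have hAE : ∀ x y, E x y → x ∈ A → y ∈ A := fun x y hxy hx => by
      rw [hA, Set.mem_iInter₂] at hx ⊢
      exact fun X hX => mem_lowerAppr_of_equiv hE hxy (hx X hX)
    have hAZ : A ⊆ lowerAppr T Z := fun x hx u hu => by
      rw [hA, Set.mem_iInter₂] at hx
      rw [hZ, Set.mem_iInter₂]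
      exact fun X hX => ⟨x, hsymm _ _ hu, lowerAppr_subset hE _ (hx X hX)⟩
    refine ⟨A ∪ {c | rep c = c ∧ c ∉ SigmaE E ∧ c ∈ lowerAppr T Z}, ?_, ?_⟩
    · refine Set.Subset.antisymm (fun x hx => ?_) fun x hx y hxy => Or.inl (hAE x y hxy hx)
      by_contra hxA
      have hfix : ∀ y, E x y → rep y = y ∧ y ∉ SigmaE E := fun y hxy => by
        rcases hx y hxy with hy | hy
        · exact absurd (hAE y x (hE.symm hxy) hy) hxA
        · exact ⟨hy.1, hy.2.1⟩
      refine (hfix x (hE.refl x)).2 (Set.Subset.antisymm (fun y hxy => ?_)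
        (Set.singleton_subset_iff.2 (hE.refl x)))
      exact (hfix y hxy).1.symm.trans ((hrep_eq x y hxy).symm.trans (hfix x (hE.refl x)).1)
    · refine Set.Subset.antisymm ?_ ?_
      · rintro w ⟨y, hwy, hy | hy⟩
        · exact ⟨y, hwy, hAZ hy⟩
        · exact ⟨y, hwy, hy.2.2⟩
      · rintro w ⟨y, hwy, hy⟩
        obtain ⟨b, hbw, hby, hb⟩ := hclique w y hwy
        have hbZ : nbhd T b ⊆ Z := fun u hu => hy u (hb _ _ hby hu)
        have of_notMem : ∀ y, y ∉ SigmaE E → nbhd T y ⊆ nbhd T b →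
            ∃ c, T w c ∧ c ∈ A ∪ {c | rep c = c ∧ c ∉ SigmaE E ∧ c ∈ lowerAppr T Z} := by
          intro y hyE hyb
          have hsub := (hcomp.nbhd_subset (hrep y)).antisymm (hcomp.nbhd_subset (hE.symm (hrep y)))
          have hrb : nbhd T (rep y) ⊆ nbhd T b := hsub ▸ hyb
          refine ⟨rep y, hb _ _ hbw (hrb (hrefl _)),
            Or.inr ⟨hrep_eq _ _ (hrep y), fun hr => hyE ?_, fun u hu => hbZ (hrb hu)⟩⟩
          have hyr : y = rep y := Set.mem_singleton_iff.1 (hr ▸ hrep y)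
          rwa [hyr]
        by_cases hbE : b ∈ SigmaE E
        · by_cases hbT : b ∈ SigmaT T
          · refine ⟨b, hsymm _ _ hbw, Or.inl (Set.mem_iInter₂.2 fun X hX => ?_)⟩
            obtain ⟨v, hbv, hvX⟩ := Set.mem_iInter₂.1 (hbZ (hrefl b)) X hX
            have hvb : v = b := Set.mem_singleton_iff.1 (hbT ▸ hbv)
            exact mem_lowerAppr_of_mem_sigmaE hbE (hvb ▸ hvX)
          · obtain ⟨y, hyE, hyb⟩ := h b ⟨hbE, hbT⟩
            exact of_notMem y hyE hyb
        · exact of_notMem b hbE subset_rfl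
end

section
/- Let E and F be equivalences on a set U with E ⊆ F. Then ( (Aᶜ)^F ∩ A^F = ∅ for every E-definable set A ⊆ U ) if and only if E = F. Consequently, under condition (CSub°), RS(E,F) is a double Stone algebra (i.e., additionally satisfies (X_E, X^F)⁺ ∧ (X_E, X^F)⁺⁺ = (∅, ∅) for all X ⊆ U, where the dual pseudocomplement of (A,B) is (Aᶜ, (Aᶜ)^F) and its double dual pseudocomplement is (A, A^F)) if and only if E = F. -/
theorem upperAppr_compl_inter_upperAppr {U : Type*} {F : U → U → Prop} (hF : Equivalence F)
    {A : Set U} (hA : ∀ x y, x ∈ A → F x y → y ∈ A) :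
    upperAppr F Aᶜ ∩ upperAppr F A = ∅ := by
  ext x
  simp only [Set.mem_inter_iff, Set.mem_empty_iff_false, iff_false]
  rintro ⟨⟨y, hxy, hy⟩, z, hxz, hz⟩
  exact hy (hA z y hz (hF.trans (hF.symm hxz) hxy))

theorem lowerAppr_eq_self {U : Type*} {E : U → U → Prop} (hE : Equivalence E)
    {A : Set U} (hA : ∀ x y, x ∈ A → E x y → y ∈ A) : lowerAppr E A = A :=
  Set.ext fun x => ⟨fun h => h x (hE.refl x), fun h y hxy => hA x y h hxy⟩

theorem mem_lowerAppr_of_rel {U : Type*} {E : U → U → Prop} (hE : Equivalence E)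
    (X : Set U) (x y : U) (hx : x ∈ lowerAppr E X) (hxy : E x y) : y ∈ lowerAppr E X :=
  fun z hyz => hx z (hE.trans hxy hyz)

theorem forall_definable_iff_eq {U : Type*} {E F : U → U → Prop}
    (hE : Equivalence E) (hF : Equivalence F) (hEF : ∀ x y, E x y → F x y) :
    (∀ A : Set U, (∀ x y, x ∈ A → E x y → y ∈ A) →
      upperAppr F Aᶜ ∩ upperAppr F A = ∅) ↔ E = F := by
  constructor
  · intro h
    funext x y
    refine propext ⟨hEF x y, fun hxy => ?_⟩
    by_contra hn
    have hy : y ∈ upperAppr F {z | E x z}ᶜ ∩ upperAppr F {z | E x z} :=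
      ⟨⟨y, hF.refl y, hn⟩, x, hF.symm hxy, hE.refl x⟩
    rw [h {z | E x z} fun a b ha hab => hE.trans ha hab] at hy
    exact hy
  · rintro rfl A hA
    exact upperAppr_compl_inter_upperAppr hE hA

/-- for equivalences `E ⊆ F` on `U`:
`(Aᶜ)^F ∩ A^F = ∅` holds for every `E`-definable set `A` iff `E = F`; and
consequently, under (CSub°), `RS(E,F)` is a double Stone algebra
(i.e. `(X_E, X^F)⁺ ∧ (X_E, X^F)⁺⁺ = (∅,∅)` for all `X ⊆ U`) iff `E = F`. -/
theorem RS_equiv_double_Stone_iff {U : Type*} (E F : U → U → Prop)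
    (hE : Equivalence E) (hF : Equivalence F)
    (hEF : ∀ x y, E x y → F x y) :
    ((∀ A : Set U, (∀ x y, x ∈ A → E x y → y ∈ A) →
        upperAppr F Aᶜ ∩ upperAppr F A = ∅) ↔ E = F) ∧
    ((∀ x : U, {y | F x y} ≠ {x} → ∃ y, F y x ∧ {z | E y z} ≠ {y}) →
      ((∀ X : Set U,
          (lowerAppr E X)ᶜ ∩ lowerAppr E X = ∅ ∧
          upperAppr F (lowerAppr E X)ᶜ ∩ upperAppr F (lowerAppr E X) = ∅) ↔ E = F)) := by
  refine ⟨forall_definable_iff_eq hE hF hEF, fun _ => ?_⟩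
  rw [← forall_definable_iff_eq hE hF hEF]
  constructor
  · intro h A hA
    simpa only [lowerAppr_eq_self hE hA] using (h A).2
  · exact fun h X => ⟨Set.compl_inter_self _, h _ (mem_lowerAppr_of_rel hE X)⟩
end
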